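/- arXiv:2106.02723 — 6 statements merged into one kernel-verified Lean document; each statement's English description precedes it below -/
import Mathlib

section
/- For every Schwartz function u : ℝ² → ℂ one has the interpolation inequality ∫_{ℝ²} |u(x)|⁴ dx ≤ (∫_{ℝ²} |∇u(x)|² dx) · (∫_{ℝ²} |u(x)|² dx); that is, ‖u‖_{L⁴(ℝ²)}⁴ ≤ ‖∇u‖_{L²(ℝ²)}² ‖u‖_{L²(ℝ²)}². -/
open MeasureTheory

open Filter Topology in
/-- A `C¹` function on the line vanishing at `±∞` satisfies `|f|² ≤ ∫ |f| |f'|` pointwise. -/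
theorem enorm_sq_le_lintegral_enorm_mul_enorm_deriv {F : Type*} [NormedAddCommGroup F]
    [InnerProductSpace ℝ F] {f f' : ℝ → F}
    (hf : ∀ t, HasDerivAt f (f' t) t) (hf' : Continuous f')
    (hbot : Tendsto f atBot (𝓝 0)) (htop : Tendsto f atTop (𝓝 0)) (a : ℝ) :
    ‖f a‖ₑ ^ 2 ≤ ∫⁻ t, ‖f t‖ₑ * ‖f' t‖ₑ := by
  have hfc : Continuous f := continuous_iff_continuousAt.2 fun t => (hf t).continuousAt
  by_cases htp : ∫⁻ t, ‖f t‖ₑ * ‖f' t‖ₑ = ⊤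
  · rw [htp]; exact le_top
  have hprod : Integrable fun t => ‖f t‖ * ‖f' t‖ := by
    refine ⟨(hfc.norm.mul hf'.norm).aestronglyMeasurable, ?_⟩
    simpa [HasFiniteIntegral, enorm_mul, lt_top_iff_ne_top] using htp
  set g' : ℝ → ℝ := fun t => 2 * inner ℝ (f t) (f' t)
  have hg : ∀ t, HasDerivAt (fun t => ‖f t‖ ^ 2) (g' t) t := fun t => (hf t).norm_sq
  have hg'c : Continuous g' := continuous_const.mul (hfc.inner hf')
  have hbound : ∀ t, ‖g' t‖ ≤ 2 * (‖f t‖ * ‖f' t‖) := fun t => by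
    simpa [g', abs_mul] using abs_real_inner_le_norm (f t) (f' t)
  have hint : Integrable g' :=
    (hprod.const_mul 2).mono' hg'c.aestronglyMeasurable (Eventually.of_forall hbound)
  have hsq : ∀ {l : Filter ℝ}, Tendsto f l (𝓝 0) → Tendsto (fun t => ‖f t‖ ^ 2) l (𝓝 0) :=
    fun h => by simpa using h.norm.pow 2
  have hleft := integral_Iic_of_hasDerivAt_of_tendsto (a := a)
    (hfc.norm.pow 2).continuousWithinAt (fun t _ => hg t) hint.integrableOn (hsq hbot)
  have hright := integral_Ioi_of_hasDerivAt_of_tendsto (a := a)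
    (hfc.norm.pow 2).continuousWithinAt (fun t _ => hg t) hint.integrableOn (hsq htop)
  have hsplit := intervalIntegral.integral_Iic_add_Ioi (b := a) hint.norm.integrableOn
    hint.norm.integrableOn
  have hl := norm_integral_le_integral_norm (μ := volume.restrict (Set.Iic a)) g'
  have hr := norm_integral_le_integral_norm (μ := volume.restrict (Set.Ioi a)) g'
  have hall : ∫ t, ‖g' t‖ ≤ 2 * ∫ t, ‖f t‖ * ‖f' t‖ := by
    rw [← integral_const_mul]
    exact integral_mono hint.norm (hprod.const_mul 2) hbound
  rw [hleft, Real.norm_eq_abs, Pi.pow_apply] at hl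
  rw [hright, Real.norm_eq_abs, Pi.pow_apply] at hr
  have key : ‖f a‖ ^ 2 ≤ ∫ t, ‖f t‖ * ‖f' t‖ := by
    linarith [le_abs_self (‖f a‖ ^ 2 - 0), neg_abs_le (0 - ‖f a‖ ^ 2)]
  have h := ENNReal.ofReal_le_ofReal key
  rw [ofReal_integral_eq_lintegral_ofReal hprod (Eventually.of_forall fun t => by positivity)] at h
  simpa [ENNReal.ofReal_pow, ENNReal.ofReal_mul] using h

open Filter Topology in
theorem SchwartzMap.enorm_sq_le_lintegral_line {E F : Type*} [NormedAddCommGroup E]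
    [NormedSpace ℝ E] [ProperSpace E] [NormedAddCommGroup F] [InnerProductSpace ℝ F]
    (u : SchwartzMap E F) (p : E) {v : E} (hv : v ≠ 0) (a : ℝ) :
    ‖u (p + a • v)‖ₑ ^ 2 ≤ ∫⁻ t : ℝ, ‖u (p + t • v)‖ₑ * ‖fderiv ℝ u (p + t • v) v‖ₑ := by
  have hemb : IsClosedEmbedding fun t : ℝ => p + t • v :=
    (Homeomorph.addLeft p).isClosedEmbedding.comp (isClosedEmbedding_smul_left hv)
  have hlim := u.tendsto_cocompact.comp hemb.tendsto_cocompact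
  refine enorm_sq_le_lintegral_enorm_mul_enorm_deriv (f := fun t : ℝ => u (p + t • v))
    (f' := fun t : ℝ => fderiv ℝ u (p + t • v) v) (fun t => ?_) ?_
    (hlim.mono_left atBot_le_cocompact) (hlim.mono_left atTop_le_cocompact) a
  · have hline : HasDerivAt (fun t : ℝ => p + t • v) v t := by
      simpa using ((hasDerivAt_id t).smul_const v).const_add p
    exact u.differentiableAt.hasFDerivAt.comp_hasDerivAt t hline
  · exact (((u.smooth 1).continuous_fderiv one_ne_zero).comp hemb.continuous).clm_apply
      continuous_const

theorem sq_lintegral_mul_le {α : Type*} [MeasurableSpace α] (μ : Measure α) {f g : α → ENNReal}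
    (hf : AEMeasurable f μ) (hg : AEMeasurable g μ) :
    (∫⁻ x, f x * g x ∂μ) ^ 2 ≤ (∫⁻ x, f x ^ 2 ∂μ) * ∫⁻ x, g x ^ 2 ∂μ := by
  have h := pow_le_pow_left'
    (ENNReal.lintegral_mul_le_Lp_mul_Lq μ Real.HolderConjugate.two_two hf hg) 2
  have hroot : ∀ c : ENNReal, (c ^ (1 / 2 : ℝ)) ^ 2 = c := fun c => by
    rw [← ENNReal.rpow_natCast, ← ENNReal.rpow_mul]; norm_num
  rw [mul_pow, hroot, hroot] at h
  simpa using h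

/-- If `f²` is bounded at each point by the integrals of `g` and of `h` along the horizontal and
the vertical line through that point, then `∫ f⁴ ≤ (∫ g) (∫ h)`. -/
theorem lintegral_pow_four_le_mul {α β : Type*} [MeasurableSpace α] [MeasurableSpace β]
    {μ : Measure α} {ν : Measure β} [SFinite μ] [SFinite ν] {f g h : α × β → ENNReal}
    (hg : Measurable g) (hh : Measurable h)
    (hfg : ∀ z, f z ^ 2 ≤ ∫⁻ x, g (x, z.2) ∂μ) (hfh : ∀ z, f z ^ 2 ≤ ∫⁻ y, h (z.1, y) ∂ν) :
    ∫⁻ z, f z ^ 4 ∂μ.prod ν ≤ (∫⁻ z, g z ∂μ.prod ν) * ∫⁻ z, h z ∂μ.prod ν := by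
  calc ∫⁻ z, f z ^ 4 ∂μ.prod ν
      ≤ ∫⁻ z, (∫⁻ y, h (z.1, y) ∂ν) * ∫⁻ x, g (x, z.2) ∂μ ∂μ.prod ν := by
        refine lintegral_mono fun z => ?_
        rw [show f z ^ 4 = f z ^ 2 * f z ^ 2 by ring]
        exact mul_le_mul' (hfh z) (hfg z)
    _ = (∫⁻ z, g z ∂μ.prod ν) * ∫⁻ z, h z ∂μ.prod ν := by
        rw [lintegral_prod_mul hh.lintegral_prod_right'.aemeasurable
          hg.lintegral_prod_left'.aemeasurable, lintegral_prod_symm g hg.aemeasurable,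
          lintegral_prod h hh.aemeasurable, mul_comm]

theorem EuclideanSpace.measurePreserving_vec_two :
    MeasurePreserving (fun z : ℝ × ℝ => (!₂[z.1, z.2] : EuclideanSpace ℝ (Fin 2))) := by
  have h := (PiLp.volume_preserving_toLp (Fin 2)).comp
    ((volume_preserving_finTwoArrow ℝ).symm MeasurableEquiv.finTwoArrow)
  exact h

theorem SchwartzMap.lintegral_enorm_pow_four_le (u : SchwartzMap (EuclideanSpace ℝ (Fin 2)) ℂ) :
    ∫⁻ x, ‖u x‖ₑ ^ 4 ≤
      (∫⁻ x, ∑ i : Fin 2, ‖fderiv ℝ u x (EuclideanSpace.single i 1)‖ₑ ^ 2) *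
        ∫⁻ x, ‖u x‖ₑ ^ 2 := by
  have hu : Measurable fun x => ‖u x‖ₑ := u.continuous.measurable.enorm
  have hd (i : Fin 2) : Measurable fun x => ‖fderiv ℝ u x (EuclideanSpace.single i 1)‖ₑ :=
    (((u.smooth 1).continuous_fderiv one_ne_zero).clm_apply continuous_const).measurable.enorm
  set G : Fin 2 → EuclideanSpace ℝ (Fin 2) → ENNReal :=
    fun i x => ‖u x‖ₑ * ‖fderiv ℝ u x (EuclideanSpace.single i 1)‖ₑ
  have hG (i : Fin 2) : Measurable (G i) := hu.mul (hd i)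
  have hΦ := EuclideanSpace.measurePreserving_vec_two
  have hne (i : Fin 2) : (EuclideanSpace.single i 1 : EuclideanSpace ℝ (Fin 2)) ≠ 0 := by simp
  have h0 (a b : ℝ) : (!₂[a, b] : EuclideanSpace ℝ (Fin 2)) =
      !₂[0, b] + a • EuclideanSpace.single 0 1 := by
    ext i; fin_cases i <;> simp
  have h1 (a b : ℝ) : (!₂[a, b] : EuclideanSpace ℝ (Fin 2)) =
      !₂[a, 0] + b • EuclideanSpace.single 1 1 := by
    ext i; fin_cases i <;> simp
  have hgrid : ∫⁻ x, ‖u x‖ₑ ^ 4 ≤ (∫⁻ x, G 0 x) * ∫⁻ x, G 1 x := by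
    rw [← hΦ.lintegral_comp (hu.pow_const 4), ← hΦ.lintegral_comp (hG 0),
      ← hΦ.lintegral_comp (hG 1)]
    refine lintegral_pow_four_le_mul (f := fun z : ℝ × ℝ => ‖u !₂[z.1, z.2]‖ₑ)
      ((hG 0).comp hΦ.measurable) ((hG 1).comp hΦ.measurable) (fun z => ?_) (fun z => ?_)
    · simpa only [← h0] using u.enorm_sq_le_lintegral_line !₂[0, z.2] (hne 0) z.1
    · simpa only [← h1] using u.enorm_sq_le_lintegral_line !₂[z.1, 0] (hne 1) z.2
  have hCS (i : Fin 2) := sq_lintegral_mul_le volume hu.aemeasurable (hd i).aemeasurable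
  calc ∫⁻ x, ‖u x‖ₑ ^ 4 ≤ (∫⁻ x, G 0 x) * ∫⁻ x, G 1 x := hgrid
    _ ≤ (∫⁻ x, G 0 x) ^ 2 + (∫⁻ x, G 1 x) ^ 2 := by
        rcases le_total (∫⁻ x, G 0 x) (∫⁻ x, G 1 x) with h | h
        · exact (mul_le_mul_left h _).trans ((sq _).ge.trans le_add_self)
        · exact (mul_le_mul_right h _).trans ((sq _).ge.trans le_self_add)
    _ ≤ _ := add_le_add (hCS 0) (hCS 1)
    _ = _ := by
        simp only [Fin.sum_univ_two]
        rw [lintegral_add_left ((hd 0).pow_const 2)]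
        ring

/-- For every Schwartz function `u : ℝ² → ℂ`,
`∫ |u|⁴ ≤ (∫ |∇u|²) · (∫ |u|²)`, where `|∇u|² = |∂₁u|² + |∂₂u|²`. -/
theorem l4_interpolation_dim2 (u : SchwartzMap (EuclideanSpace ℝ (Fin 2)) ℂ) :
    ∫ x, ‖u x‖ ^ 4 ≤
      (∫ x, ∑ i : Fin 2, ‖fderiv ℝ (fun y => u y) x (EuclideanSpace.single i 1)‖ ^ 2) *
        ∫ x, ‖u x‖ ^ 2 := by
  have hu4 : Integrable fun x => ‖u x‖ ^ 4 := (u.memLp 4).integrable_norm_pow (by norm_num)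
  have hu2 : Integrable fun x => ‖u x‖ ^ 2 := (u.memLp 2).integrable_norm_pow (by norm_num)
  have hd2 : Integrable fun x =>
      ∑ i : Fin 2, ‖fderiv ℝ (fun y => u y) x (EuclideanSpace.single i 1)‖ ^ 2 := by
    refine integrable_finsetSum _ fun i _ => ?_
    exact ((SchwartzMap.evalCLM ℝ _ ℂ (EuclideanSpace.single i 1)
      (SchwartzMap.fderivCLM ℝ _ ℂ u)).memLp 2).integrable_norm_pow (by norm_num)
  have hd0 : ∀ x, 0 ≤ ∑ i : Fin 2,
      ‖fderiv ℝ (fun y => u y) x (EuclideanSpace.single i 1)‖ ^ 2 := fun x => by positivity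
  rw [← ENNReal.ofReal_le_ofReal_iff (by positivity), ENNReal.ofReal_mul (by positivity),
    ofReal_integral_eq_lintegral_ofReal hu4 (.of_forall fun x => by positivity),
    ofReal_integral_eq_lintegral_ofReal hu2 (.of_forall fun x => by positivity),
    ofReal_integral_eq_lintegral_ofReal hd2 (.of_forall hd0)]
  convert u.lintegral_enorm_pow_four_le using 3 <;>
    simp [ENNReal.ofReal_pow, ENNReal.ofReal_add]
end

section
/- Let d ≥ 1 be an integer and let Q : ℝ^d → ℝ be a ground state. Then E(Q) = 0, i.e. (1/2)∫_{ℝ^d} |∇Q(x)|² dx = (d/(2(d+2))) ∫_{ℝ^d} Q(x)^{2(d+2)/d} dx. -/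
open MeasureTheory

/-- The partial derivative of `f` in the `i`-th coordinate direction. -/
noncomputable def pd {d : ℕ} {E : Type*} [NormedAddCommGroup E] [NormedSpace ℝ E]
    (i : Fin d) (f : EuclideanSpace ℝ (Fin d) → E) (x : EuclideanSpace ℝ (Fin d)) : E :=
  fderiv ℝ f x (EuclideanSpace.single i 1)

/-- The Laplacian of `f`, as the sum of the second partial derivatives. -/
noncomputable def lap {d : ℕ} {E : Type*} [NormedAddCommGroup E] [NormedSpace ℝ E]
    (f : EuclideanSpace ℝ (Fin d) → E) (x : EuclideanSpace ℝ (Fin d)) : E :=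
  ∑ i : Fin d, pd i (pd i f) x

/-- A ground state: a smooth, positive, radially symmetric solution of
`ΔQ + Q^(1+4/d) = Q` which decays exponentially together with all its derivatives. -/
structure IsGroundState (d : ℕ) (Q : EuclideanSpace ℝ (Fin d) → ℝ) : Prop where
  smooth : ContDiff ℝ (⊤ : ℕ∞) Q
  pos : ∀ x, 0 < Q x
  radial : ∀ x y, ‖x‖ = ‖y‖ → Q x = Q y
  eqn : ∀ x, lap Q x + Q x ^ ((1 : ℝ) + 4 / d) = Q x
  decay : ∃ δ > (0:ℝ), ∀ n : ℕ, ∃ C : ℝ, ∀ x, ‖iteratedFDeriv ℝ n Q x‖ ≤ C * Real.exp (-δ * ‖x‖)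

open scoped SchwartzMap

section PartialDerivatives

variable {d : ℕ} {f g : EuclideanSpace ℝ (Fin d) → ℝ} {x : EuclideanSpace ℝ (Fin d)}

theorem pd_add (i : Fin d) (hf : DifferentiableAt ℝ f x) (hg : DifferentiableAt ℝ g x) :
    pd i (fun y => f y + g y) x = pd i f x + pd i g x := by
  simp [pd, fderiv_fun_add hf hg]

theorem pd_sub (i : Fin d) (hf : DifferentiableAt ℝ f x) (hg : DifferentiableAt ℝ g x) :
    pd i (fun y => f y - g y) x = pd i f x - pd i g x := by
  simp [pd, fderiv_fun_sub hf hg]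

theorem pd_const_mul (i : Fin d) (c : ℝ) (hf : DifferentiableAt ℝ f x) :
    pd i (fun y => c * f y) x = c * pd i f x := by
  simp [pd, fderiv_const_mul hf]

theorem pd_mul (i : Fin d) (hf : DifferentiableAt ℝ f x) (hg : DifferentiableAt ℝ g x) :
    pd i (fun y => f y * g y) x = pd i f x * g x + f x * pd i g x := by
  simp [pd, fderiv_fun_mul hf hg]
  ring

theorem pd_sum {ι : Type*} (s : Finset ι) {F : ι → EuclideanSpace ℝ (Fin d) → ℝ} (i : Fin d)
    (hF : ∀ k ∈ s, DifferentiableAt ℝ (F k) x) :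
    pd i (fun y => ∑ k ∈ s, F k y) x = ∑ k ∈ s, pd i (F k) x := by
  simp [pd, fderiv_fun_sum hF]

theorem pd_rpow_const (i : Fin d) (hf : DifferentiableAt ℝ f x) (hx : f x ≠ 0) (p : ℝ) :
    pd i (fun y => f y ^ p) x = p * f x ^ (p - 1) * pd i f x := by
  simp [pd, (hf.hasFDerivAt.rpow_const (p := p) (Or.inl hx)).fderiv]

theorem differentiable_coord (j : Fin d) :
    Differentiable ℝ (fun y : EuclideanSpace ℝ (Fin d) => y j) :=
  (EuclideanSpace.proj j : EuclideanSpace ℝ (Fin d) →L[ℝ] ℝ).differentiable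

theorem pd_coord (i j : Fin d) (x : EuclideanSpace ℝ (Fin d)) :
    pd i (fun y => y j) x = if i = j then 1 else 0 := by
  have h : fderiv ℝ (fun y : EuclideanSpace ℝ (Fin d) => y j) x =
      (EuclideanSpace.proj j : EuclideanSpace ℝ (Fin d) →L[ℝ] ℝ) :=
    (EuclideanSpace.proj j : EuclideanSpace ℝ (Fin d) →L[ℝ] ℝ).fderiv
  simp [pd, h, eq_comm]

theorem pd_comm (i j : Fin d) (hf : ContDiff ℝ 2 f) (x : EuclideanSpace ℝ (Fin d)) :
    pd i (pd j f) x = pd j (pd i f) x := by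
  have hd : DifferentiableAt ℝ (fderiv ℝ f) x :=
    (hf.fderiv_right (m := 1) (by norm_num)).differentiable (by norm_num) x
  have key : ∀ k l : Fin d, pd k (pd l f) x =
      fderiv ℝ (fderiv ℝ f) x (EuclideanSpace.single k 1) (EuclideanSpace.single l 1) := by
    intro k l
    change fderiv ℝ (fun y => fderiv ℝ f y (EuclideanSpace.single l 1)) x _ = _
    rw [fderiv_clm_apply hd (differentiableAt_const _)]
    simp
  rw [key, key]
  exact (hf.contDiffAt.isSymmSndFDerivAt (by simp)).eq _ _

end PartialDerivatives

/-- `f` is (the underlying function of) a Schwartz function. -/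
def IsSchwartz {d : ℕ} (f : EuclideanSpace ℝ (Fin d) → ℝ) : Prop :=
  ∃ g : 𝓢(EuclideanSpace ℝ (Fin d), ℝ), ⇑g = f

namespace IsSchwartz

variable {d : ℕ} {f g : EuclideanSpace ℝ (Fin d) → ℝ}

theorem of_exp_decay (hf : ContDiff ℝ (⊤ : ℕ∞) f) {δ : ℝ} (hδ : 0 < δ)
    (h : ∀ n : ℕ, ∃ C : ℝ, ∀ x, ‖iteratedFDeriv ℝ n f x‖ ≤ C * Real.exp (-δ * ‖x‖)) :
    IsSchwartz f := by
  refine ⟨⟨f, hf, fun k n => ?_⟩, rfl⟩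
  obtain ⟨C, hC⟩ := h n
  have hC0 : 0 ≤ C := by simpa using (norm_nonneg _).trans (hC 0)
  refine ⟨C * (k.factorial / δ ^ k), fun x => ?_⟩
  have h1 := Real.pow_div_factorial_le_exp (x := δ * ‖x‖) (by positivity) k
  have h2 : ‖x‖ ^ k * Real.exp (-δ * ‖x‖) ≤ k.factorial / δ ^ k := by
    rw [neg_mul, Real.exp_neg, ← div_eq_mul_inv, div_le_div_iff₀ (by positivity) (by positivity)]
    rw [div_le_iff₀ (by positivity), mul_pow] at h1
    linarith
  calc ‖x‖ ^ k * ‖iteratedFDeriv ℝ n f x‖ ≤ ‖x‖ ^ k * (C * Real.exp (-δ * ‖x‖)) := by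
        gcongr
        exact hC x
    _ = C * (‖x‖ ^ k * Real.exp (-δ * ‖x‖)) := by ring
    _ ≤ _ := by gcongr

theorem differentiable (hf : IsSchwartz f) : Differentiable ℝ f := by
  obtain ⟨F, rfl⟩ := hf
  exact F.differentiable

theorem integrable (hf : IsSchwartz f) : Integrable f := by
  obtain ⟨F, rfl⟩ := hf
  exact F.integrable

theorem add (hf : IsSchwartz f) (hg : IsSchwartz g) : IsSchwartz (fun x => f x + g x) := by
  obtain ⟨F, rfl⟩ := hf
  obtain ⟨G, rfl⟩ := hg
  exact ⟨F + G, rfl⟩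

theorem sub (hf : IsSchwartz f) (hg : IsSchwartz g) : IsSchwartz (fun x => f x - g x) := by
  obtain ⟨F, rfl⟩ := hf
  obtain ⟨G, rfl⟩ := hg
  exact ⟨F - G, rfl⟩

theorem const_mul (c : ℝ) (hf : IsSchwartz f) : IsSchwartz (fun x => c * f x) := by
  obtain ⟨F, rfl⟩ := hf
  exact ⟨c • F, rfl⟩

theorem sum {ι : Type*} (s : Finset ι) {F : ι → EuclideanSpace ℝ (Fin d) → ℝ}
    (hF : ∀ k, IsSchwartz (F k)) : IsSchwartz (fun x => ∑ k ∈ s, F k x) := by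
  choose G hG using hF
  refine ⟨∑ k ∈ s, G k, funext fun x => ?_⟩
  simp [← hG]

theorem temperate_mul (hg : g.HasTemperateGrowth) (hf : IsSchwartz f) :
    IsSchwartz (fun x => g x * f x) := by
  obtain ⟨F, rfl⟩ := hf
  exact ⟨SchwartzMap.smulLeftCLM ℝ g F, SchwartzMap.smulLeftCLM_apply hg F⟩

theorem mul (hf : IsSchwartz f) (hg : IsSchwartz g) : IsSchwartz (fun x => f x * g x) := by
  obtain ⟨F, rfl⟩ := hf
  exact temperate_mul F.hasTemperateGrowth hg

theorem coord_mul (j : Fin d) (hf : IsSchwartz f) : IsSchwartz (fun x => x j * f x) :=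
  temperate_mul
    (EuclideanSpace.proj j : EuclideanSpace ℝ (Fin d) →L[ℝ] ℝ).hasTemperateGrowth hf

theorem pd (i : Fin d) (hf : IsSchwartz f) : IsSchwartz (pd i f) := by
  obtain ⟨F, rfl⟩ := hf
  exact ⟨SchwartzMap.evalCLM ℝ _ _ (EuclideanSpace.single i 1) (SchwartzMap.fderivCLM ℝ _ _ F), rfl⟩

theorem integral_pd (i : Fin d) (hf : IsSchwartz f) : ∫ x, _root_.pd i f x = 0 := by
  have h := integral_mul_fderiv_eq_neg_fderiv_mul_of_integrable (μ := volume)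
    (f := fun _ : EuclideanSpace ℝ (Fin d) => (1 : ℝ)) (g := f) (v := EuclideanSpace.single i 1)
    (by simp) (by simpa using! (hf.pd i).integrable) (by simpa using hf.integrable)
    (fun _ _ => differentiableAt_const _) (fun x _ => hf.differentiable x)
  simpa using! h

end IsSchwartz

namespace IsGroundState

variable {d : ℕ} {Q : EuclideanSpace ℝ (Fin d) → ℝ}

theorem isSchwartz (hQ : IsGroundState d Q) : IsSchwartz Q := by
  obtain ⟨δ, hδ, h⟩ := hQ.decay
  exact .of_exp_decay hQ.smooth hδ h

theorem lap_eq (hQ : IsGroundState d Q) (x : EuclideanSpace ℝ (Fin d)) :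
    ∑ i : Fin d, pd i (pd i Q) x = Q x - Q x ^ ((1 : ℝ) + 4 / d) :=
  eq_sub_of_add_eq (hQ.eqn x)

theorem rpow_add_one (hd : 1 ≤ d) (hQ : IsGroundState d Q) (x : EuclideanSpace ℝ (Fin d)) :
    Q x ^ ((2 * ((d : ℝ) + 2)) / d) = Q x * Q x ^ ((1 : ℝ) + 4 / d) := by
  have hd' : (d : ℝ) ≠ 0 := by positivity
  rw [← Real.rpow_one_add' (hQ.pos x).le (by positivity)]
  congr 1
  field_simp
  ring

theorem isSchwartz_rpow (hd : 1 ≤ d) (hQ : IsGroundState d Q) :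
    IsSchwartz (fun x => Q x ^ ((2 * ((d : ℝ) + 2)) / d)) := by
  have h : IsSchwartz (fun x => Q x * (Q x - ∑ i : Fin d, pd i (pd i Q) x)) :=
    hQ.isSchwartz.mul (hQ.isSchwartz.sub (.sum _ fun i => (hQ.isSchwartz.pd i).pd i))
  simpa [hQ.lap_eq, hQ.rpow_add_one hd] using h

theorem pd_rpow (hd : 1 ≤ d) (hQ : IsGroundState d Q) (i : Fin d)
    (x : EuclideanSpace ℝ (Fin d)) :
    pd i (fun y => Q y ^ ((2 * ((d : ℝ) + 2)) / d)) x =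
      (2 * ((d : ℝ) + 2)) / d * Q x ^ ((1 : ℝ) + 4 / d) * pd i Q x := by
  have hd' : (d : ℝ) ≠ 0 := by positivity
  rw [pd_rpow_const i (hQ.isSchwartz.differentiable x) (hQ.pos x).ne']
  congr 3
  field_simp
  ring

/-- A divergence identity: the Pohozaev identity for the dilation in the direction `j`,
combined with the identity obtained by testing the equation against `Q`. -/
theorem divergence_identity (hd : 1 ≤ d) (hQ : IsGroundState d Q) (j : Fin d)
    (x : EuclideanSpace ℝ (Fin d)) :
    (∑ i : Fin d, pd i (fun y => y j * (pd j Q y * pd i Q y) + (1 / 2) * (Q y * pd i Q y)) x) +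
      pd j (fun y => y j * (d / (2 * ((d : ℝ) + 2)) * Q y ^ ((2 * ((d : ℝ) + 2)) / d) -
        (1 / 2) * (Q y * Q y + ∑ i : Fin d, pd i Q y * pd i Q y))) x =
    pd j Q x ^ 2 - 1 / ((d : ℝ) + 2) * Q x ^ ((2 * ((d : ℝ) + 2)) / d) := by
  have hd' : (d : ℝ) ≠ 0 := by positivity
  have hS := hQ.isSchwartz
  have hP := hQ.isSchwartz_rpow hd
  have hgrad : IsSchwartz (fun y => ∑ i : Fin d, pd i Q y * pd i Q y) :=
    .sum _ fun i => (hS.pd i).mul (hS.pd i)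
  have hA : ∀ i : Fin d,
      pd i (fun y => y j * (pd j Q y * pd i Q y) + (1 / 2) * (Q y * pd i Q y)) x =
        (if i = j then pd j Q x * pd i Q x else 0) + x j * (pd i Q x * pd j (pd i Q) x) +
          x j * pd j Q x * pd i (pd i Q) x + (1 / 2) * (pd i Q x * pd i Q x) +
          (1 / 2) * Q x * pd i (pd i Q) x := by
    intro i
    rw [pd_add i (((hS.pd j).mul (hS.pd i)).coord_mul j |>.differentiable x)
        ((hS.mul (hS.pd i)).const_mul _ |>.differentiable x),
      pd_mul i (differentiable_coord j x) (((hS.pd j).mul (hS.pd i)).differentiable x),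
      pd_const_mul i _ ((hS.mul (hS.pd i)).differentiable x),
      pd_mul i ((hS.pd j).differentiable x) ((hS.pd i).differentiable x),
      pd_mul i (hS.differentiable x) ((hS.pd i).differentiable x), pd_coord,
      pd_comm i j (contDiff_infty.1 hQ.smooth 2)]
    split_ifs <;> ring
  have hB : pd j (fun y => ∑ i : Fin d, pd i Q y * pd i Q y) x =
      2 * ∑ i : Fin d, pd i Q x * pd j (pd i Q) x := by
    rw [pd_sum _ _ fun i _ => ((hS.pd i).mul (hS.pd i)).differentiable x, Finset.mul_sum]
    refine Finset.sum_congr rfl fun i _ => ?_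
    rw [pd_mul j ((hS.pd i).differentiable x) ((hS.pd i).differentiable x)]
    ring
  have hE := (hS.mul hS).add hgrad
  simp_rw [hA]
  rw [pd_mul j (differentiable_coord j x)
      (((hP.const_mul _).sub (hE.const_mul _)).differentiable x),
    pd_sub j ((hP.const_mul _).differentiable x) ((hE.const_mul _).differentiable x),
    pd_const_mul j _ (hP.differentiable x), pd_const_mul j _ (hE.differentiable x),
    pd_add j ((hS.mul hS).differentiable x) (hgrad.differentiable x),
    pd_mul j (hS.differentiable x) (hS.differentiable x), hB, hQ.pd_rpow hd, pd_coord]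
  simp only [Finset.sum_add_distrib, ← Finset.mul_sum, hQ.lap_eq, hQ.rpow_add_one hd,
    Finset.sum_ite_eq', Finset.mem_univ, if_true]
  field_simp
  ring

theorem integral_sq_pd (hd : 1 ≤ d) (hQ : IsGroundState d Q) (j : Fin d) :
    ∫ x, pd j Q x ^ 2 = 1 / ((d : ℝ) + 2) * ∫ x, Q x ^ ((2 * ((d : ℝ) + 2)) / d) := by
  have hS := hQ.isSchwartz
  have hP := hQ.isSchwartz_rpow hd
  have hA : ∀ i : Fin d, IsSchwartz
      (fun y => y j * (pd j Q y * pd i Q y) + (1 / 2) * (Q y * pd i Q y)) := fun i =>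
    (((hS.pd j).mul (hS.pd i)).coord_mul j).add ((hS.mul (hS.pd i)).const_mul _)
  have hB : IsSchwartz
      (fun y => y j * (d / (2 * ((d : ℝ) + 2)) * Q y ^ ((2 * ((d : ℝ) + 2)) / d) -
        (1 / 2) * (Q y * Q y + ∑ i : Fin d, pd i Q y * pd i Q y))) :=
    ((hP.const_mul _).sub (((hS.mul hS).add
      (.sum _ fun i => (hS.pd i).mul (hS.pd i))).const_mul _)).coord_mul j
  have h := integral_congr_ae (μ := volume) (.of_forall (hQ.divergence_identity hd j))
  have hsq : Integrable (fun x => pd j Q x ^ 2) := by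
    simpa only [pow_two] using ((hS.pd j).mul (hS.pd j)).integrable
  rw [integral_add (integrable_finsetSum _ fun i _ => ((hA i).pd i).integrable)
      (hB.pd j).integrable, integral_finsetSum _ fun i _ => ((hA i).pd i).integrable,
    hB.integral_pd, Finset.sum_eq_zero fun i _ => (hA i).integral_pd i,
    integral_sub hsq (hP.const_mul _).integrable, integral_const_mul] at h
  linarith

end IsGroundState

/-- The ground state has zero energy:
`(1/2)∫|∇Q|² = (d/(2(d+2))) ∫ Q^(2(d+2)/d)`. -/
theorem energy_of_ground_state_eq_zero (d : ℕ) (hd : 1 ≤ d)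
    (Q : EuclideanSpace ℝ (Fin d) → ℝ) (hQ : IsGroundState d Q) :
    (1/2) * ∫ x, ∑ i : Fin d, (pd i Q x) ^ 2 =
      ((d : ℝ) / (2 * ((d : ℝ) + 2))) * ∫ x, Q x ^ ((2 * ((d : ℝ) + 2)) / d) := by
  have hS := hQ.isSchwartz
  have hsq : ∀ i : Fin d, Integrable (fun x => pd i Q x ^ 2) := fun i => by
    simpa only [pow_two] using ((hS.pd i).mul (hS.pd i)).integrable
  rw [integral_finsetSum _ fun i _ => hsq i]
  simp only [hQ.integral_sq_pd hd, Finset.sum_const, Finset.card_univ, Fintype.card_fin,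
    nsmul_eq_mul]
  field_simp
end

section
/- Let d ≥ 1 and let Q : ℝ^d → ℝ be a ground state which in addition satisfies the two-sided decay bounds: for every ε > 0 there exist constants c_ε, C_ε > 0 with c_ε e^{−(1+ε)|x|} ≤ Q(x) ≤ C_ε e^{−(1−ε)|x|} for all x ∈ ℝ^d, and Q is strictly radially decreasing (its radial profile q satisfies q'(r) < 0 for all r > 0). Then for every α > 0 the function ∇Q/Q^{1−α} is uniformly bounded: there exists C_α > 0 such that |∇Q(x)| ≤ C_α Q(x)^{1−α} for all x ∈ ℝ^d. -/
open MeasureTheory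

/-- A sequence of sets of decay rates that is midpoint concave in the index, with top rate `a` at
index `0`, has rates arbitrarily close to `a` at index `1`. -/
lemma exists_rate_gt_of_midpoint (P : ℕ → ℝ → Prop) {a b : ℝ} (ha : 0 ≤ a) (h0 : P 0 a)
    (hz : ∀ k, P k 0)
    (hmid : ∀ k b c, 0 ≤ b → 0 ≤ c → P k b → P (k + 2) c → P (k + 1) ((b + c) / 2))
    (hb : b < a) : ∃ c > b, P 1 c := by
  set S : ℕ → Set ℝ := fun k => {c | (0 ≤ c ∧ c ≤ a) ∧ P k c} with hS
  have hbdd : ∀ k, BddAbove (S k) := fun k => ⟨a, fun c hc => hc.1.2⟩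
  have hne : ∀ k, (S k).Nonempty := fun k => ⟨0, ⟨le_rfl, ha⟩, hz k⟩
  set A : ℕ → ℝ := fun k => sSup (S k) with hA
  have hA0 : a ≤ A 0 := le_csSup (hbdd 0) ⟨⟨ha, le_rfl⟩, h0⟩
  have hA0' : A 0 ≤ a := csSup_le (hne 0) fun c hc => hc.1.2
  have hnonneg : ∀ k, 0 ≤ A k := fun k => le_csSup (hbdd k) ⟨⟨le_rfl, ha⟩, hz k⟩
  have hconc : ∀ k, A k + A (k + 2) ≤ 2 * A (k + 1) := by
    intro k
    have h1 : ∀ c ∈ S (k + 2), ∀ b ∈ S k, b ≤ 2 * A (k + 1) - c := by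
      intro c hc b hb
      have : (b + c) / 2 ≤ A (k + 1) :=
        le_csSup (hbdd _) ⟨⟨by linarith [hb.1.1, hc.1.1], by linarith [hb.1.2, hc.1.2]⟩,
          hmid k b c hb.1.1 hc.1.1 hb.2 hc.2⟩
      linarith
    have h2 : ∀ c ∈ S (k + 2), c ≤ 2 * A (k + 1) - A k := by
      intro c hc
      have := csSup_le (hne k) (h1 c hc)
      linarith
    have := csSup_le (hne (k + 2)) h2
    linarith
  by_contra! hcon
  have hA1 : A 1 ≤ b := csSup_le (hne 1) fun c hc => by
    by_contra! h
    exact hcon c h hc.2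
  have hstep : ∀ k, A (k + 1) ≤ A k - (a - b) := by
    intro k
    induction k with
    | zero => simp only [zero_add]; linarith
    | succ k ih => linarith [hconc k]
  have hlin : ∀ k : ℕ, A k ≤ a - k * (a - b) := by
    intro k
    induction k with
    | zero => simpa using hA0'
    | succ k ih => push_cast; linarith [hstep k]
  obtain ⟨n, hn⟩ := exists_nat_gt (a / (a - b))
  rw [div_lt_iff₀ (sub_pos.2 hb)] at hn
  linarith [hlin n, hnonneg n]

section Landau

variable {E G : Type*} [NormedAddCommGroup E] [NormedAddCommGroup G] [NormedSpace ℝ G]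

lemma norm_image_sub_sub_fderiv_le [NormedSpace ℝ E] {F : E → G} (hF : ContDiff ℝ 2 F)
    {M : ℝ} {x w : E}
    (hM : ∀ z ∈ segment ℝ x (x + w), ‖fderiv ℝ (fderiv ℝ F) z‖ ≤ M) :
    ‖F (x + w) - F x - fderiv ℝ F x w‖ ≤ M * ‖w‖ ^ 2 := by
  have hconv := convex_segment (𝕜 := ℝ) x (x + w)
  have hx := left_mem_segment ℝ x (x + w)
  have hM0 : 0 ≤ M := (norm_nonneg (fderiv ℝ (fderiv ℝ F) x)).trans (hM x hx)
  have hdiff : Differentiable ℝ (fderiv ℝ F) :=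
    (hF.fderiv_right (m := 1) (by norm_num)).differentiable (by norm_num)
  have hlip : ∀ z ∈ segment ℝ x (x + w), ‖fderiv ℝ F z - fderiv ℝ F x‖ ≤ M * ‖w‖ := by
    intro z hz
    refine (hconv.norm_image_sub_le_of_norm_fderiv_le (fun y _ => hdiff y) hM hx hz).trans ?_
    have := norm_sub_le_of_mem_segment hz
    gcongr
    simpa using this
  have := hconv.norm_image_sub_le_of_norm_hasFDerivWithin_le'
    (fun z _ => ((hF.differentiable (by norm_num)) z).hasFDerivAt.hasFDerivWithinAt) hlip hx
    (right_mem_segment ℝ x (x + w))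
  simp only [add_sub_cancel_left] at this
  linarith

/-- Landau's inequality for exponential decay rates: the rate of the first derivative is at least
the mean of the rates of the function and of its second derivative. -/
lemma norm_fderiv_le_exp_of_norm_le_exp [InnerProductSpace ℝ E] {F : E → G}
    (hF : ContDiff ℝ 2 F) {a b K M : ℝ} (ha : 0 ≤ a) (hb : 0 ≤ b)
    (hK : ∀ x, ‖F x‖ ≤ K * Real.exp (-a * ‖x‖))
    (hM : ∀ x, ‖fderiv ℝ (fderiv ℝ F) x‖ ≤ M * Real.exp (-b * ‖x‖)) (x : E) :
    ‖fderiv ℝ F x‖ ≤ (2 * K + M) * Real.exp (-((a + b) / 2) * ‖x‖) := by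
  have hK0 : 0 ≤ K := by
    have := (norm_nonneg _).trans (hK 0)
    simpa using this
  have hM0 : 0 ≤ M := by
    have := (norm_nonneg (fderiv ℝ (fderiv ℝ F) 0)).trans (hM 0)
    simpa using this
  have outward : ∀ v : E, ‖v‖ = 1 → 0 ≤ inner ℝ x v →
      ‖fderiv ℝ F x v‖ ≤ (2 * K + M) * Real.exp (-((a + b) / 2) * ‖x‖) := by
    intro v hv hxv
    set h := Real.exp (-((a - b) / 2) * ‖x‖) with hh
    have hpos : 0 < h := Real.exp_pos _
    have hgrow : ∀ t : ℝ, 0 ≤ t → ‖x‖ ≤ ‖x + t • v‖ := by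
      intro t ht
      refine le_of_sq_le_sq ?_ (norm_nonneg _)
      rw [norm_add_sq_real, inner_smul_right]
      nlinarith [mul_nonneg ht hxv, sq_nonneg ‖t • v‖]
    have hseg : ∀ z ∈ segment ℝ x (x + h • v),
        ‖fderiv ℝ (fderiv ℝ F) z‖ ≤ M * Real.exp (-b * ‖x‖) := by
      intro z hz
      rw [segment_eq_image'] at hz
      obtain ⟨t, ht, rfl⟩ := hz
      refine (hM _).trans ?_
      have h1 := hgrow (t * h) (mul_nonneg ht.1 hpos.le)
      simp only [add_sub_cancel_left, smul_smul]
      gcongr M * Real.exp ?_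
      nlinarith
    have hT := norm_image_sub_sub_fderiv_le hF hseg
    have h2 : ‖F (x + h • v)‖ ≤ K * Real.exp (-a * ‖x‖) := by
      refine (hK _).trans ?_
      have := hgrow h hpos.le
      gcongr K * Real.exp ?_
      nlinarith
    have hnorm : ‖h • v‖ = h := by rw [norm_smul, hv, mul_one, Real.norm_of_nonneg hpos.le]
    have h3 : h * ‖fderiv ℝ F x v‖ = ‖fderiv ℝ F x (h • v)‖ := by
      rw [map_smul, norm_smul, Real.norm_of_nonneg hpos.le]
    have h4 : h * ‖fderiv ℝ F x v‖ ≤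
        2 * K * Real.exp (-a * ‖x‖) + M * Real.exp (-b * ‖x‖) * h ^ 2 := by
      rw [h3]
      have e : fderiv ℝ F x (h • v) =
          (F (x + h • v) - F x) - (F (x + h • v) - F x - fderiv ℝ F x (h • v)) := by abel
      rw [e]
      rw [hnorm] at hT
      refine (norm_sub_le _ _).trans ?_
      linarith [norm_sub_le (F (x + h • v)) (F x), hK x]
    have e1 : Real.exp (-a * ‖x‖) = h * Real.exp (-((a + b) / 2) * ‖x‖) := by
      rw [hh, ← Real.exp_add]; ring_nf
    have e2 : Real.exp (-b * ‖x‖) * h = Real.exp (-((a + b) / 2) * ‖x‖) := by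
      rw [hh, ← Real.exp_add]; ring_nf
    have h5 : h * ‖fderiv ℝ F x v‖ ≤
        h * ((2 * K + M) * Real.exp (-((a + b) / 2) * ‖x‖)) := by
      refine h4.trans (le_of_eq ?_)
      rw [e1, ← e2]; ring
    exact le_of_mul_le_mul_left h5 hpos
  refine ContinuousLinearMap.opNorm_le_of_unit_norm (by positivity) fun v hv => ?_
  rcases le_total 0 (inner ℝ x v) with h | h
  · exact outward v hv h
  · have := outward (-v) (by rwa [norm_neg]) (by rw [inner_neg_right]; linarith)
    rwa [map_neg, norm_neg] at this

end Landau

set_option maxSynthPendingDepth 10 in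
lemma norm_fderiv_fderiv_iteratedFDeriv {E G : Type*} [NormedAddCommGroup E] [NormedSpace ℝ E]
    [NormedAddCommGroup G] [NormedSpace ℝ G] (F : E → G) (k : ℕ) (x : E) :
    ‖fderiv ℝ (fderiv ℝ (iteratedFDeriv ℝ k F)) x‖ = ‖iteratedFDeriv ℝ (k + 2) F x‖ := by
  rw [← norm_iteratedFDeriv_one, fderiv_iteratedFDeriv,
    LinearIsometryEquiv.norm_iteratedFDeriv_comp_left, norm_iteratedFDeriv_one,
    norm_fderiv_iteratedFDeriv]

/-- If a smooth function decays at rate `a` and all its derivatives are bounded, then its first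
derivative decays at every rate below `a`. -/
lemma exists_norm_fderiv_le_exp {E G : Type*} [NormedAddCommGroup E] [InnerProductSpace ℝ E]
    [NormedAddCommGroup G] [NormedSpace ℝ G] {F : E → G} (hF : ContDiff ℝ (⊤ : ℕ∞) F)
    (hbdd : ∀ n : ℕ, ∃ C : ℝ, ∀ x, ‖iteratedFDeriv ℝ n F x‖ ≤ C) {a b C₀ : ℝ} (ha : 0 ≤ a)
    (hdecay : ∀ x, ‖F x‖ ≤ C₀ * Real.exp (-a * ‖x‖)) (hb : b < a) :
    ∃ C : ℝ, 0 ≤ C ∧ ∀ x, ‖fderiv ℝ F x‖ ≤ C * Real.exp (-b * ‖x‖) := by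
  obtain ⟨c, hc, C, hC⟩ := exists_rate_gt_of_midpoint
    (fun k b => ∃ C : ℝ, ∀ x, ‖iteratedFDeriv ℝ k F x‖ ≤ C * Real.exp (-b * ‖x‖)) ha
    ⟨C₀, by simpa using hdecay⟩ (fun k => by simpa using hbdd k)
    (by
      rintro k b c hb hc ⟨K, hK⟩ ⟨M, hM⟩
      refine ⟨2 * K + M, fun x => ?_⟩
      rw [← norm_fderiv_iteratedFDeriv]
      refine norm_fderiv_le_exp_of_norm_le_exp
        ((contDiff_infty.1 hF (2 + k)).iteratedFDeriv_right (by norm_cast)) hb hc hK (fun y => ?_) x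
      rw [norm_fderiv_fderiv_iteratedFDeriv]
      exact hM y) hb
  have hC0 : 0 ≤ C := by
    have := (norm_nonneg _).trans (hC 0)
    simpa using this
  refine ⟨C, hC0, fun x => ?_⟩
  rw [← norm_iteratedFDeriv_one]
  refine (hC x).trans ?_
  gcongr C * Real.exp ?_
  nlinarith [norm_nonneg x]

/-- If the ground state `Q` satisfies the two-sided exponential decay bounds
`c_ε e^{-(1+ε)|x|} ≤ Q(x) ≤ C_ε e^{-(1-ε)|x|}` and is strictly radially decreasing, then for
every `α > 0` the function `∇Q / Q^(1-α)` is uniformly bounded. -/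
theorem grad_le_pow_of_ground_state (d : ℕ) (hd : 1 ≤ d)
    (Q : EuclideanSpace ℝ (Fin d) → ℝ) (hQ : IsGroundState d Q)
    (hdecay : ∀ ε > (0:ℝ), ∃ c > (0:ℝ), ∃ C > (0:ℝ), ∀ x,
      c * Real.exp (-(1 + ε) * ‖x‖) ≤ Q x ∧ Q x ≤ C * Real.exp (-(1 - ε) * ‖x‖))
    (hdec : ∃ q : ℝ → ℝ, (∀ x, Q x = q ‖x‖) ∧ ∀ r > (0:ℝ), deriv q r < 0) :
    ∀ α > (0:ℝ), ∃ C > (0:ℝ), ∀ x, ‖gradient Q x‖ ≤ C * Q x ^ ((1:ℝ) - α) := by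
  intro α hα
  obtain ⟨δ, hδ, hder⟩ := hQ.decay
  have hbdd : ∀ n : ℕ, ∃ C : ℝ, ∀ x, ‖iteratedFDeriv ℝ n Q x‖ ≤ C := by
    intro n
    obtain ⟨C, hC⟩ := hder n
    have hC0 : 0 ≤ C := by
      have := (norm_nonneg _).trans (hC 0)
      simpa using this
    refine ⟨C, fun x => (hC x).trans (mul_le_of_le_one_right hC0 ?_)⟩
    rw [Real.exp_le_one_iff]
    nlinarith [norm_nonneg x]
  have hgrad : ∀ x, ‖gradient Q x‖ = ‖fderiv ℝ Q x‖ := fun x => by simp [gradient]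
  suffices h : ∃ K : ℝ, ∃ c > (0 : ℝ), ∃ b : ℝ, 0 ≤ K ∧
      (∀ x, ‖fderiv ℝ Q x‖ ≤ K * Real.exp (-b * ‖x‖)) ∧
      ∀ x, c * Real.exp (-b * ‖x‖) ≤ Q x ^ ((1 : ℝ) - α) by
    obtain ⟨K, c, hc, b, hK0, hK, hQc⟩ := h
    refine ⟨(K + 1) / c, by positivity, fun x => ?_⟩
    rw [hgrad]
    calc ‖fderiv ℝ Q x‖ ≤ K * Real.exp (-b * ‖x‖) := hK x
      _ ≤ (K + 1) * Real.exp (-b * ‖x‖) := by gcongr; linarith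
      _ = (K + 1) / c * (c * Real.exp (-b * ‖x‖)) := by field_simp
      _ ≤ (K + 1) / c * Q x ^ ((1 : ℝ) - α) := by gcongr; exact hQc x
  rcases le_or_gt 1 α with h1 | h1
  · obtain ⟨K, hK⟩ := hbdd 1
    simp only [norm_iteratedFDeriv_one] at hK
    obtain ⟨_, _, C, hC, h⟩ := hdecay 1 one_pos
    refine ⟨K, C ^ ((1 : ℝ) - α), by positivity, 0, (norm_nonneg _).trans (hK 0),
      by simpa using hK, fun x => ?_⟩
    simpa using Real.rpow_le_rpow_of_nonpos (hQ.pos x) (by simpa using (h x).2)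
      (sub_nonpos.2 h1)
  · obtain ⟨c, hc, _, _, hlow⟩ := hdecay α hα
    obtain ⟨_, _, C₀, _, hup⟩ := hdecay (α ^ 2 / 2) (by positivity)
    obtain ⟨K, hK0, hK⟩ := exists_norm_fderiv_le_exp (b := (1 + α) * (1 - α)) hQ.smooth hbdd
      (by nlinarith : 0 ≤ 1 - α ^ 2 / 2)
      (fun x => by rw [Real.norm_of_nonneg (hQ.pos x).le]; exact (hup x).2) (by nlinarith)
    refine ⟨K, c ^ ((1 : ℝ) - α), by positivity, (1 + α) * (1 - α), hK0, hK, fun x => ?_⟩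
    have := Real.rpow_le_rpow (by positivity) (hlow x).1 (sub_nonneg.2 h1.le)
    rw [Real.mul_rpow hc.le (Real.exp_pos _).le, ← Real.exp_mul] at this
    convert this using 3
    ring
end

section
/- Let d ≥ 1, let Q : ℝ^d → ℝ be a ground state, and let χ₀ : ℝ^d → ℝ be a positive, radially symmetric Schwartz function with ‖χ₀‖_{L²} = 1 satisfying 𝓛χ₀ = −λ₀ χ₀ for some λ₀ > 0. Then ∫_{ℝ^d} ((d/2) Q + x·∇Q) χ₀ dx = (2/λ₀) ∫_{ℝ^d} Q χ₀ dx, and this quantity is strictly positive. -/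
open MeasureTheory

/-- The linearized operator `𝓛 f = -Δf + f - (1 + 4/d) Q^(4/d) f`. -/
noncomputable def linL (d : ℕ) (Q f : EuclideanSpace ℝ (Fin d) → ℝ)
    (x : EuclideanSpace ℝ (Fin d)) : ℝ :=
  -(lap f x) + f x - (1 + 4 / (d : ℝ)) * Q x ^ ((4:ℝ) / d) * f x

open LineDeriv Laplacian SchwartzMap

namespace SchwartzMap

variable {d : ℕ}

theorem lap_coe (f : 𝓢(EuclideanSpace ℝ (Fin d), ℝ)) (x : EuclideanSpace ℝ (Fin d)) :
    lap f x = Δ f x := by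
  rw [laplacian_eq_sum (EuclideanSpace.basisFun (Fin d) ℝ), sum_apply]
  simp only [EuclideanSpace.basisFun_apply]
  rfl

theorem lineDerivOp_comm {E F : Type*} [NormedAddCommGroup E] [NormedSpace ℝ E]
    [NormedAddCommGroup F] [NormedSpace ℝ F] (v w : E) (f : 𝓢(E, F)) :
    ∂_{v} (∂_{w} f) = ∂_{w} (∂_{v} f) := by
  ext x
  have key (a b : E) : ∂_{a} (∂_{b} f) x = fderiv ℝ (fderiv ℝ f) x a b := by
    have h : DifferentiableAt ℝ (fderiv ℝ f) x := (fderivCLM ℝ E F f).differentiableAt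
    change fderiv ℝ (fun y ↦ fderiv ℝ f y b) x a = _
    rw [fderiv_clm_apply h (differentiableAt_const b)]
    simp
  rw [key, key]
  have hs : IsSymmSndFDerivAt ℝ f x :=
    ((f.smooth 2).contDiffAt).isSymmSndFDerivAt (by simp)
  exact hs v w

theorem laplacian_lineDerivOp (v : EuclideanSpace ℝ (Fin d))
    (f : 𝓢(EuclideanSpace ℝ (Fin d), ℝ)) : Δ (∂_{v} f) = ∂_{v} (Δ f) := by
  simp only [laplacian_eq_sum (EuclideanSpace.basisFun (Fin d) ℝ), lineDerivOp_sum]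
  refine Finset.sum_congr rfl fun i _ ↦ ?_
  rw [lineDerivOp_comm _ v f, lineDerivOp_comm _ v]

/-- Multiplication of a Schwartz function by the `j`-th coordinate. -/
noncomputable def mulCoord (j : Fin d) (f : 𝓢(EuclideanSpace ℝ (Fin d), ℝ)) :
    𝓢(EuclideanSpace ℝ (Fin d), ℝ) :=
  smulLeftCLM ℝ (fun x : EuclideanSpace ℝ (Fin d) ↦ x j) f

theorem mulCoord_apply (j : Fin d) (f : 𝓢(EuclideanSpace ℝ (Fin d), ℝ))
    (x : EuclideanSpace ℝ (Fin d)) : mulCoord j f x = x j * f x :=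
  smulLeftCLM_apply_apply
    (EuclideanSpace.proj j : EuclideanSpace ℝ (Fin d) →L[ℝ] ℝ).hasTemperateGrowth f x

theorem lineDerivOp_mulCoord (v : EuclideanSpace ℝ (Fin d)) (j : Fin d)
    (f : 𝓢(EuclideanSpace ℝ (Fin d), ℝ)) :
    ∂_{v} (mulCoord j f) = v j • f + mulCoord j (∂_{v} f) := by
  ext x
  have h : (mulCoord j f : EuclideanSpace ℝ (Fin d) → ℝ) =
      fun y ↦ (EuclideanSpace.proj j : EuclideanSpace ℝ (Fin d) →L[ℝ] ℝ) y * f y :=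
    funext fun y ↦ mulCoord_apply j f y
  rw [lineDerivOp_apply_eq_fderiv, h,
    fderiv_fun_mul (ContinuousLinearMap.differentiableAt _) f.differentiableAt,
    ContinuousLinearMap.fderiv]
  simp [mulCoord_apply, lineDerivOp_apply_eq_fderiv]
  ring

theorem laplacian_mulCoord (j : Fin d) (f : 𝓢(EuclideanSpace ℝ (Fin d), ℝ)) :
    Δ (mulCoord j f) = (2 : ℝ) • ∂_{EuclideanSpace.single j (1 : ℝ)} f + mulCoord j (Δ f) := by
  ext x
  simp only [laplacian_eq_sum (EuclideanSpace.basisFun (Fin d) ℝ), lineDerivOp_mulCoord,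
    lineDerivOp_add, lineDerivOp_smul, EuclideanSpace.basisFun_apply, sum_apply, add_apply,
    smul_apply, mulCoord_apply, smul_eq_mul, Finset.sum_add_distrib, Finset.mul_sum,
    PiLp.single_apply, ite_mul, one_mul, zero_mul, Finset.sum_ite_eq, Finset.mem_univ, if_true]
  ring

/-- The generator `d/2 + x·∇` of the `L²`-invariant scaling on Schwartz functions. -/
noncomputable def scalingGen (f : 𝓢(EuclideanSpace ℝ (Fin d), ℝ)) :
    𝓢(EuclideanSpace ℝ (Fin d), ℝ) :=
  ((d : ℝ) / 2) • f + ∑ j, mulCoord j (∂_{EuclideanSpace.single j (1 : ℝ)} f)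

theorem scalingGen_apply (f : 𝓢(EuclideanSpace ℝ (Fin d), ℝ)) (x : EuclideanSpace ℝ (Fin d)) :
    scalingGen f x = (d : ℝ) / 2 * f x + ∑ j, x j * pd j f x := by
  simp only [scalingGen, add_apply, smul_apply, sum_apply, mulCoord_apply, smul_eq_mul]
  rfl

theorem laplacian_scalingGen_apply (f : 𝓢(EuclideanSpace ℝ (Fin d), ℝ))
    (x : EuclideanSpace ℝ (Fin d)) :
    Δ (scalingGen f) x = ((d : ℝ) / 2 + 2) * Δ f x +
      ∑ j, x j * pd j (Δ f : 𝓢(EuclideanSpace ℝ (Fin d), ℝ)) x := by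
  have h : Δ (scalingGen f) = ((d : ℝ) / 2) • Δ f +
      ∑ j, Δ (mulCoord j (∂_{EuclideanSpace.single j (1 : ℝ)} f)) := by
    simp only [scalingGen, ← laplacianCLM_eq', map_add, map_smul, map_sum]
  have hsum : ∑ j : Fin d, ∂_{EuclideanSpace.single j (1 : ℝ)}
      (∂_{EuclideanSpace.single j (1 : ℝ)} f) = Δ f := by
    simp only [laplacian_eq_sum (EuclideanSpace.basisFun (Fin d) ℝ),
      EuclideanSpace.basisFun_apply]
  rw [h]
  simp only [laplacian_mulCoord, laplacian_lineDerivOp, Finset.sum_add_distrib,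
    ← Finset.smul_sum, hsum, add_apply, smul_apply, sum_apply, mulCoord_apply, smul_eq_mul]
  simp only [lineDerivOp_apply_eq_fderiv, pd]
  ring

end SchwartzMap

theorem IsGroundState.exists_schwartzMap {d : ℕ} {Q : EuclideanSpace ℝ (Fin d) → ℝ}
    (hQ : IsGroundState d Q) : ∃ q : 𝓢(EuclideanSpace ℝ (Fin d), ℝ), ⇑q = Q := by
  refine ⟨⟨Q, hQ.smooth, fun k n ↦ ?_⟩, rfl⟩
  obtain ⟨δ, hδ, h⟩ := hQ.decay
  obtain ⟨C, hC⟩ := h n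
  refine ⟨k.factorial / δ ^ k * C, fun x ↦ ?_⟩
  have hexp : ‖x‖ ^ k * Real.exp (-δ * ‖x‖) ≤ k.factorial / δ ^ k := by
    have hpow := Real.pow_div_factorial_le_exp (δ * ‖x‖) (by positivity) k
    rw [neg_mul, Real.exp_neg, ← div_eq_mul_inv, div_le_div_iff₀ (Real.exp_pos _) (by positivity),
      ← mul_pow, mul_comm ‖x‖]
    rwa [div_le_iff₀' (by positivity)] at hpow
  have hC0 : 0 ≤ C :=
    nonneg_of_mul_nonneg_left ((norm_nonneg _).trans (hC x)) (Real.exp_pos _)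
  calc ‖x‖ ^ k * ‖iteratedFDeriv ℝ n Q x‖ ≤ ‖x‖ ^ k * (C * Real.exp (-δ * ‖x‖)) := by
        gcongr; exact hC x
    _ = ‖x‖ ^ k * Real.exp (-δ * ‖x‖) * C := by ring
    _ ≤ _ := by gcongr

/-- The algebraic identity `𝓛(ΛQ) = -2Q` for the scaling generator `Λ`. -/
theorem IsGroundState.linL_scalingGen {d : ℕ} (hd : 1 ≤ d)
    {q : 𝓢(EuclideanSpace ℝ (Fin d), ℝ)} (hQ : IsGroundState d q)
    (x : EuclideanSpace ℝ (Fin d)) : linL d q (scalingGen q) x = -2 * q x := by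
  have hlap : ⇑(Δ q : 𝓢(EuclideanSpace ℝ (Fin d), ℝ)) = fun y ↦ q y - q y ^ ((1 : ℝ) + 4 / d) := by
    ext y
    have := hQ.eqn y
    rw [lap_coe] at this
    linarith
  have hpd (j : Fin d) :
      pd j (Δ q : 𝓢(EuclideanSpace ℝ (Fin d), ℝ)) x = (1 - (1 + 4 / (d : ℝ)) * q x ^ ((4 : ℝ) / d)) * pd j q x := by
    have hq := q.hasFDerivAt x
    rw [pd, hlap, (hq.fun_sub (hq.rpow_const (p := 1 + 4 / (d : ℝ)) (.inl (hQ.pos x).ne'))).fderiv]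
    simp [pd]
    ring
  have hpow : q x ^ ((1 : ℝ) + 4 / d) = q x * q x ^ ((4 : ℝ) / d) := by
    rw [Real.rpow_add (hQ.pos x), Real.rpow_one]
  have hd0 : (d : ℝ) ≠ 0 := by positivity
  simp only [linL, lap_coe, laplacian_scalingGen_apply, hpd, scalingGen_apply,
    mul_left_comm (x.ofLp _), ← Finset.mul_sum]
  simp only [hlap, hpow]
  field_simp
  ring

/-- Pairing of the scaling generator `ΛQ = (d/2)Q + x·∇Q` with the negative
eigenfunction `χ₀` of `𝓛`:  `∫ ΛQ χ₀ = (2/λ₀) ∫ Q χ₀ > 0`. -/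
theorem scalingGen_inner_groundEigenfunction (d : ℕ) (hd : 1 ≤ d)
    (Q : EuclideanSpace ℝ (Fin d) → ℝ) (hQ : IsGroundState d Q)
    (χ₀ : SchwartzMap (EuclideanSpace ℝ (Fin d)) ℝ)
    (hχpos : ∀ x, 0 < χ₀ x)
    (hχrad : ∀ x y, ‖x‖ = ‖y‖ → χ₀ x = χ₀ y)
    (hχnorm : ∫ x, (χ₀ x) ^ 2 = 1)
    (lam₀ : ℝ) (hlam₀ : 0 < lam₀)
    (hχeig : ∀ x, linL d Q (fun y => χ₀ y) x = -lam₀ * χ₀ x) :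
    (∫ x, (((d : ℝ) / 2) * Q x + ∑ j : Fin d, x j * pd j Q x) * χ₀ x)
        = (2 / lam₀) * ∫ x, Q x * χ₀ x ∧
      0 < ∫ x, (((d : ℝ) / 2) * Q x + ∑ j : Fin d, x j * pd j Q x) * χ₀ x := by
  obtain ⟨q, rfl⟩ := hQ.exists_schwartzMap
  have hmul (f g : 𝓢(EuclideanSpace ℝ (Fin d), ℝ)) : Integrable fun x ↦ f x * g x :=
    (pairing (ContinuousLinearMap.mul ℝ ℝ) f g).integrable
  have hpoint (x) : scalingGen q x * Δ χ₀ x - Δ (scalingGen q) x * χ₀ x =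
      lam₀ * (scalingGen q x * χ₀ x) - 2 * (q x * χ₀ x) := by
    have h₁ := hQ.linL_scalingGen hd x
    have h₂ := hχeig x
    simp only [linL, lap_coe] at h₁ h₂
    linear_combination χ₀ x * h₁ - scalingGen q x * h₂
  have hsymm := integral_mul_laplacian_right_eq_left (μ := volume) (scalingGen q) χ₀
  have hpair : lam₀ * ∫ x, scalingGen q x * χ₀ x = 2 * ∫ x, q x * χ₀ x := by
    rw [← sub_eq_zero, ← integral_sub (hmul _ _) (hmul _ _)] at hsymm
    simp only [hpoint] at hsymm
    rwa [integral_sub ((hmul _ _).const_mul _) ((hmul _ _).const_mul _), integral_const_mul,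
      integral_const_mul, sub_eq_zero] at hsymm
  simp only [← scalingGen_apply]
  have heq : ∫ x, scalingGen q x * χ₀ x = 2 / lam₀ * ∫ x, q x * χ₀ x := by
    field_simp
    linarith
  have hpos : 0 < ∫ x, q x * χ₀ x :=
    integral_pos_of_integrable_nonneg_nonzero (x := 0) (q.continuous.mul χ₀.continuous)
      (hmul _ _) (fun x ↦ (mul_pos (hQ.pos x) (hχpos x)).le) (mul_pos (hQ.pos 0) (hχpos 0)).ne'
  exact ⟨heq, by rw [heq]; positivity⟩
end

section
/- Let d ≥ 1, let Q : ℝ^d → ℝ be a ground state, and let u(t,x) := t^{−d/2} e^{−i/t} e^{i|x|²/(4t)} Q(x/t) for t > 0. Then for every t > 0, ∫_{ℝ^d} |∇_x u(t,x)|² dx = (1/4) ∫_{ℝ^d} |x|² Q(x)² dx + t^{−2} ∫_{ℝ^d} |∇Q(x)|² dx. In particular ‖∇_x u(t)‖_{L²} → ∞ as t ↘ 0 whenever ∇Q is not identically zero. -/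
open MeasureTheory Filter

/-- The polynomial factor `(1 + ‖x‖)²` is absorbed by exponential decay. -/
theorem integrable_of_le_exp_neg_norm {d : ℕ} {f : EuclideanSpace ℝ (Fin d) → ℝ}
    (hf : Continuous f) {C a : ℝ} (ha : 0 < a)
    (hb : ∀ x, |f x| ≤ C * ((1 + ‖x‖) ^ 2 * Real.exp (-a * ‖x‖))) : Integrable f := by
  set n := d + 1 + 2
  have hint : Integrable (fun x : EuclideanSpace ℝ (Fin d) => (1 + ‖x‖) ^ (-((d + 1 : ℕ) : ℝ))) := by
    apply integrable_one_add_norm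
    simp
  have hC : 0 ≤ C := by simpa using (abs_nonneg _).trans (hb 0)
  refine (hint.const_mul (C * (n.factorial * Real.exp a / a ^ n))).mono'
    hf.aestronglyMeasurable (Eventually.of_forall fun x => ?_)
  rw [Real.norm_eq_abs]
  refine (hb x).trans ?_
  rw [mul_assoc]
  refine mul_le_mul_of_nonneg_left ?_ hC
  have hr : 0 < 1 + ‖x‖ := by positivity
  have hexp := Real.pow_div_factorial_le_exp (a * (1 + ‖x‖)) (by positivity) n
  rw [Real.rpow_neg hr.le, Real.rpow_natCast, ← div_eq_mul_inv, div_div, le_div_iff₀ (by positivity)]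
  rw [div_le_iff₀ (by positivity)] at hexp
  calc (1 + ‖x‖) ^ 2 * Real.exp (-a * ‖x‖) * (a ^ n * (1 + ‖x‖) ^ (d + 1))
      = (a * (1 + ‖x‖)) ^ n * Real.exp (-a * ‖x‖) := by
        rw [mul_pow, show n = d + 1 + 2 from rfl, pow_add (1 + ‖x‖)]; ring
    _ ≤ (Real.exp (a * (1 + ‖x‖)) * n.factorial) * Real.exp (-a * ‖x‖) := by gcongr
    _ = n.factorial * (Real.exp (a * (1 + ‖x‖)) * Real.exp (-a * ‖x‖)) := by ring
    _ = n.factorial * Real.exp a := by rw [← Real.exp_add]; ring_nf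

namespace IsGroundState

variable {d : ℕ} {Q : EuclideanSpace ℝ (Fin d) → ℝ}

theorem continuous_pd (hQ : IsGroundState d Q) (j : Fin d) : Continuous (pd j Q) :=
  (hQ.smooth.continuous_fderiv (by simp)).clm_apply continuous_const

theorem integrable_norm_sq_mul_sq (hQ : IsGroundState d Q) :
    Integrable (fun x => ‖x‖ ^ 2 * Q x ^ 2) := by
  obtain ⟨δ, hδ, h⟩ := hQ.decay
  obtain ⟨C, hC⟩ := h 0
  refine integrable_of_le_exp_neg_norm (C := C ^ 2) (a := 2 * δ)
    ((continuous_norm.pow 2).mul (hQ.smooth.continuous.pow 2)) (by positivity) fun x => ?_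
  have hx := hC x
  rw [norm_iteratedFDeriv_zero] at hx
  rw [abs_of_nonneg (by positivity), ← sq_abs (Q x), ← Real.norm_eq_abs]
  calc ‖x‖ ^ 2 * ‖Q x‖ ^ 2 ≤ (1 + ‖x‖) ^ 2 * (C * Real.exp (-δ * ‖x‖)) ^ 2 := by
        gcongr; linarith
    _ = C ^ 2 * ((1 + ‖x‖) ^ 2 * Real.exp (-(2 * δ) * ‖x‖)) := by
        rw [mul_pow, ← Real.exp_nat_mul]; push_cast; ring_nf

theorem integrable_pd_sq (hQ : IsGroundState d Q) (j : Fin d) :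
    Integrable (fun x => pd j Q x ^ 2) := by
  obtain ⟨δ, hδ, h⟩ := hQ.decay
  obtain ⟨C, hC⟩ := h 1
  refine integrable_of_le_exp_neg_norm (C := C ^ 2) (a := 2 * δ)
    ((hQ.continuous_pd j).pow 2) (by positivity) fun x => ?_
  have hx : ‖pd j Q x‖ ≤ C * Real.exp (-δ * ‖x‖) := by
    refine le_trans ?_ (hC x)
    rw [norm_iteratedFDeriv_one]
    simpa [pd] using (fderiv ℝ Q x).le_opNorm (EuclideanSpace.single j 1)
  rw [abs_of_nonneg (by positivity), ← sq_abs (pd j Q x), ← Real.norm_eq_abs]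
  calc ‖pd j Q x‖ ^ 2 ≤ 1 * (C * Real.exp (-δ * ‖x‖)) ^ 2 := by rw [one_mul]; gcongr
    _ ≤ (1 + ‖x‖) ^ 2 * (C * Real.exp (-δ * ‖x‖)) ^ 2 := by
        gcongr
        nlinarith [norm_nonneg x]
    _ = C ^ 2 * ((1 + ‖x‖) ^ 2 * Real.exp (-(2 * δ) * ‖x‖)) := by
        rw [mul_pow, ← Real.exp_nat_mul]; push_cast; ring_nf

end IsGroundState

theorem pd_phase_mul_dilation {d : ℕ} {Q : EuclideanSpace ℝ (Fin d) → ℝ}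
    (hQ : Differentiable ℝ Q) (c : ℂ) (t : ℝ) (j : Fin d) (x : EuclideanSpace ℝ (Fin d)) :
    pd j (fun y => c * Complex.exp (Complex.I * ((‖y‖ ^ 2 : ℝ) : ℂ) / (4 * (t : ℂ))) *
        (Q (t⁻¹ • y) : ℂ)) x =
      c * Complex.exp ((‖x‖ ^ 2 / (4 * t) : ℝ) * Complex.I) *
        (((t⁻¹ * pd j Q (t⁻¹ • x) : ℝ) : ℂ) +
          ((2⁻¹ * (t⁻¹ • x) j * Q (t⁻¹ • x) : ℝ) : ℂ) * Complex.I) := by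
  set e : EuclideanSpace ℝ (Fin d) := EuclideanSpace.single j 1 with he
  have hphase : HasFDerivAt (fun y : EuclideanSpace ℝ (Fin d) => ‖y‖ ^ 2)
      (2 • innerSL ℝ x) x := (hasStrictFDerivAt_norm_sq x).hasFDerivAt
  have hdil : HasFDerivAt (fun y => Q (t⁻¹ • y))
      ((fderiv ℝ Q (t⁻¹ • x)).comp (t⁻¹ • ContinuousLinearMap.id ℝ _)) x :=
    (hQ (t⁻¹ • x)).hasFDerivAt.comp x ((hasFDerivAt_id x).const_smul t⁻¹)
  have hphaseC := Complex.ofRealCLM.hasFDerivAt.comp x hphase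
  have hdilC := Complex.ofRealCLM.hasFDerivAt.comp x hdil
  have hexp := (hphaseC.const_mul (Complex.I / (4 * (t : ℂ)))).cexp
  have hmul := (hexp.const_mul c).mul hdilC
  have hfun : (fun y => c * Complex.exp (Complex.I * ((‖y‖ ^ 2 : ℝ) : ℂ) / (4 * (t : ℂ))) *
        (Q (t⁻¹ • y) : ℂ)) = fun y : EuclideanSpace ℝ (Fin d) =>
      c * Complex.exp (Complex.I / (4 * (t : ℂ)) * ((‖y‖ ^ 2 : ℝ) : ℂ)) * (Q (t⁻¹ • y) : ℂ) := by
    funext y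
    rw [div_mul_eq_mul_div]
  have hderiv := congrArg (fun L => L e) hmul.fderiv
  have harg : Complex.I / (4 * (t : ℂ)) * ((‖x‖ ^ 2 : ℝ) : ℂ) =
      (‖x‖ ^ 2 / (4 * t) : ℝ) * Complex.I := by
    push_cast; ring
  have hinner : inner ℝ x e = x j := by simp [he, EuclideanSpace.inner_single_right]
  rw [hfun]
  refine hderiv.trans ?_
  simp only [hinner, pd, ← he, Function.comp_apply, Complex.ofRealCLM_apply, harg,
    add_apply, smul_apply, ContinuousLinearMap.comp_apply,
    ContinuousLinearMap.id_apply, innerSL_apply_apply, map_smul, smul_eq_mul, nsmul_eq_mul,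
    PiLp.smul_apply]
  push_cast
  ring

theorem sum_norm_pd_sq {d : ℕ} {Q : EuclideanSpace ℝ (Fin d) → ℝ}
    (hQ : Differentiable ℝ Q) (c : ℂ) (t : ℝ) (x : EuclideanSpace ℝ (Fin d)) :
    ∑ j : Fin d, ‖pd j (fun y => c * Complex.exp (Complex.I * ((‖y‖ ^ 2 : ℝ) : ℂ) /
        (4 * (t : ℂ))) * (Q (t⁻¹ • y) : ℂ)) x‖ ^ 2 =
      ‖c‖ ^ 2 * ((1 / 4) * (‖t⁻¹ • x‖ ^ 2 * Q (t⁻¹ • x) ^ 2) +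
        t⁻¹ ^ 2 * ∑ j : Fin d, pd j Q (t⁻¹ • x) ^ 2) := by
  rw [EuclideanSpace.real_norm_sq_eq, Finset.sum_mul, Finset.mul_sum, Finset.mul_sum,
    ← Finset.sum_add_distrib, Finset.mul_sum]
  refine Finset.sum_congr rfl fun j _ => ?_
  rw [pd_phase_mul_dilation hQ, norm_mul, norm_mul, Complex.norm_exp_ofReal_mul_I, mul_one,
    mul_pow, Complex.sq_norm (_ + _), Complex.normSq_add_mul_I]
  ring

/-- For the pseudoconformal soliton
`u(t,x) = t^{-d/2} e^{-i/t} e^{i|x|²/(4t)} Q(x/t)`, for each `t > 0`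
`∫ |∇ₓu(t,x)|² dx = (1/4)∫ |x|² Q(x)² dx + t⁻² ∫ |∇Q|² dx`; in particular
`‖∇ₓu(t)‖_{L²} → ∞` as `t ↘ 0` whenever `∇Q` is not identically zero. -/
theorem pseudoconformal_gradient_blowup (d : ℕ) (hd : 1 ≤ d)
    (Q : EuclideanSpace ℝ (Fin d) → ℝ) (hQ : IsGroundState d Q)
    (u : ℝ → EuclideanSpace ℝ (Fin d) → ℂ)
    (hu : ∀ t x, u t x =
      ((t ^ (-(d : ℝ) / 2) : ℝ) : ℂ) * Complex.exp (-Complex.I / (t : ℂ)) *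
        Complex.exp (Complex.I * ((‖x‖ ^ 2 : ℝ) : ℂ) / (4 * (t : ℂ))) *
        (Q (t⁻¹ • x) : ℂ)) :
    (∀ t : ℝ, 0 < t →
      ∫ x, ∑ j : Fin d, ‖pd j (u t) x‖ ^ 2
        = (1/4) * (∫ x, ‖x‖ ^ 2 * (Q x) ^ 2)
          + t⁻¹ ^ 2 * ∫ x, ∑ j : Fin d, (pd j Q x) ^ 2) ∧
    ((∃ x, ∃ j : Fin d, pd j Q x ≠ 0) →
      Tendsto (fun t : ℝ => Real.sqrt (∫ x, ∑ j : Fin d, ‖pd j (u t) x‖ ^ 2))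
        (nhdsWithin 0 (Set.Ioi 0)) atTop) := by
  have hdiff : Differentiable ℝ Q := hQ.smooth.differentiable (by simp)
  have hIgrad : Integrable (fun x => ∑ j : Fin d, (pd j Q x) ^ 2) :=
    integrable_finsetSum _ fun j _ => hQ.integrable_pd_sq j
  have hmain : ∀ t : ℝ, 0 < t →
      ∫ x, ∑ j : Fin d, ‖pd j (u t) x‖ ^ 2
        = (1/4) * (∫ x, ‖x‖ ^ 2 * (Q x) ^ 2)
          + t⁻¹ ^ 2 * ∫ x, ∑ j : Fin d, (pd j Q x) ^ 2 := by
    intro t ht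
    have hc : ‖((t ^ (-(d : ℝ) / 2) : ℝ) : ℂ) * Complex.exp (-Complex.I / (t : ℂ))‖ ^ 2 =
        (t ^ d)⁻¹ := by
      have harg : -Complex.I / (t : ℂ) = ((-t⁻¹ : ℝ) : ℂ) * Complex.I := by
        push_cast; ring
      rw [harg, norm_mul, Complex.norm_exp_ofReal_mul_I, mul_one, Complex.norm_real,
        Real.norm_eq_abs, sq_abs, ← Real.rpow_natCast, ← Real.rpow_mul ht.le,
        ← Real.rpow_natCast, ← Real.rpow_neg ht.le]
      congr 1
      push_cast
      ring
    rw [funext (hu t)]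
    simp_rw [sum_norm_pd_sq hdiff, hc]
    rw [integral_const_mul, Measure.integral_comp_inv_smul volume
      (fun y : EuclideanSpace ℝ (Fin d) => (1 / 4) * (‖y‖ ^ 2 * Q y ^ 2) +
        t⁻¹ ^ 2 * ∑ j : Fin d, pd j Q y ^ 2),
      integral_add (hQ.integrable_norm_sq_mul_sq.const_mul _) (hIgrad.const_mul _),
      integral_const_mul, integral_const_mul, finrank_euclideanSpace_fin,
      abs_of_pos (by positivity), smul_eq_mul, inv_mul_cancel_left₀ (by positivity)]
  refine ⟨hmain, ?_⟩
  rintro ⟨x₀, j₀, hx₀⟩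
  have hpos : 0 < ∫ x, ∑ j : Fin d, (pd j Q x) ^ 2 := by
    refine integral_pos_of_integrable_nonneg_nonzero (x := x₀)
      (continuous_finsetSum _ fun j _ => (hQ.continuous_pd j).pow 2) hIgrad
      (fun x => Finset.sum_nonneg fun j _ => sq_nonneg _) ?_
    refine (lt_of_lt_of_le (by positivity : 0 < pd j₀ Q x₀ ^ 2) ?_).ne'
    exact Finset.single_le_sum (f := fun j => pd j Q x₀ ^ 2) (fun j _ => sq_nonneg _)
      (Finset.mem_univ j₀)
  refine Real.tendsto_sqrt_atTop.comp ?_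
  refine Tendsto.congr' (f₁ := fun t : ℝ => (1/4) * (∫ x, ‖x‖ ^ 2 * (Q x) ^ 2)
          + t⁻¹ ^ 2 * ∫ x, ∑ j : Fin d, (pd j Q x) ^ 2) ?_ ?_
  · filter_upwards [self_mem_nhdsWithin] with t ht using (hmain t ht).symm
  · exact tendsto_atTop_add_const_left _ _
      (((tendsto_pow_atTop two_ne_zero).comp tendsto_inv_nhdsGT_zero).atTop_mul_const hpos)
end

section
/- Let χ : ℝ² → ℝ be a smooth function with 0 ≤ χ ≤ 1, χ(x) = 1 for |x| ≤ 1, and χ supported in {|x| ≤ 2}. Then there exists a constant C > 0, depending only on χ, such that for every R > 0 and every Schwartz function g : ℝ² → ℂ, ∫_{ℝ²} χ(x/(2R))² |g(x)|⁴ dx ≤ C ( ‖χ(·/(2R)) ∇g‖_{L²(ℝ²)}² ‖g‖_{L²(ℝ²)}² + R^{−2} ‖g‖_{L²(ℝ²)}⁴ ). -/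
open MeasureTheory

/-- The operator norm of the derivative is bounded by the Euclidean norm of the gradient. -/
theorem norm_fderiv_sq_le_sum_pd_sq {d : ℕ} {E : Type*} [NormedAddCommGroup E] [NormedSpace ℝ E]
    (f : EuclideanSpace ℝ (Fin d) → E) (x : EuclideanSpace ℝ (Fin d)) :
    ‖fderiv ℝ f x‖ ^ 2 ≤ ∑ i, ‖pd i f x‖ ^ 2 := by
  have hS : 0 ≤ ∑ i, ‖pd i f x‖ ^ 2 := by positivity
  have h : ‖fderiv ℝ f x‖ ≤ √(∑ i, ‖pd i f x‖ ^ 2) := by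
    refine ContinuousLinearMap.opNorm_le_bound _ (Real.sqrt_nonneg _) fun v => ?_
    have hv : v = ∑ i, v i • EuclideanSpace.single i (1 : ℝ) := by
      simpa using ((EuclideanSpace.basisFun (Fin d) ℝ).sum_repr v).symm
    calc ‖fderiv ℝ f x v‖ = ‖∑ i, v i • pd i f x‖ := by
          conv_lhs => rw [hv]
          simp [pd, map_sum]
      _ ≤ ∑ i, ‖pd i f x‖ * ‖v i‖ := by
          refine (norm_sum_le _ _).trans_eq (Finset.sum_congr rfl fun i _ => ?_)
          rw [norm_smul, mul_comm]
      _ ≤ √(∑ i, ‖pd i f x‖ ^ 2) * √(∑ i, ‖v i‖ ^ 2) := Real.sum_mul_le_sqrt_mul_sqrt _ _ _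
      _ = √(∑ i, ‖pd i f x‖ ^ 2) * ‖v‖ := by rw [EuclideanSpace.norm_eq]
  exact (Real.le_sqrt (norm_nonneg _) hS).1 h

/-- The Gagliardo–Nirenberg–Sobolev inequality `W^{1,1} ⊆ L²` in the plane, in terms of Bochner
integrals. -/
theorem exists_integral_norm_sq_le_integral_norm_fderiv_sq :
    ∃ K : ℝ, 0 ≤ K ∧ ∀ u : EuclideanSpace ℝ (Fin 2) → ℂ, ContDiff ℝ 1 u → HasCompactSupport u →
      ∫ x, ‖u x‖ ^ 2 ≤ K * (∫ x, ‖fderiv ℝ u x‖) ^ 2 := by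
  refine ⟨lintegralPowLePowLIntegralFDerivConst
    (volume : Measure (EuclideanSpace ℝ (Fin 2))) 2, NNReal.coe_nonneg _, fun u hu hc => ?_⟩
  have hp : Real.HolderConjugate (Module.finrank ℝ (EuclideanSpace ℝ (Fin 2)) : ℝ) 2 := by
    simpa using Real.HolderConjugate.two_two
  have key := lintegral_pow_le_pow_lintegral_fderiv volume hu hc hp
  have hi : Integrable (fderiv ℝ u) :=
    (hu.continuous_fderiv one_ne_zero).integrable_of_hasCompactSupport (hc.fderiv ℝ)
  rw [← ofReal_integral_norm_eq_lintegral_enorm hi] at key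
  have hu2 : ∫⁻ x, ‖u x‖ₑ ^ (2 : ℝ) = ENNReal.ofReal (∫ x, ‖u x‖ ^ 2) := by
    rw [ofReal_integral_eq_lintegral_ofReal]
    · refine lintegral_congr fun x => ?_
      rw [ENNReal.ofReal_pow (norm_nonneg _), ofReal_norm, ENNReal.rpow_two]
    · simp_rw [sq]
      exact (hu.continuous.norm.mul hu.continuous.norm).integrable_of_hasCompactSupport
        hc.norm.mul_right
    · exact ae_of_all _ fun x => sq_nonneg ‖u x‖
  have hI : 0 ≤ ∫ x, ‖fderiv ℝ u x‖ := integral_nonneg fun _ => norm_nonneg _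
  rw [hu2, ENNReal.rpow_two, ← ENNReal.ofReal_pow hI, ← ENNReal.ofReal_coe_nnreal,
    ← ENNReal.ofReal_mul (NNReal.coe_nonneg _)] at key
  exact (ENNReal.ofReal_le_ofReal_iff (by positivity)).1 key

/-- The Cauchy–Schwarz inequality for the Bochner integral of nonnegative functions. -/
theorem integral_mul_le_sqrt_mul_sqrt {α : Type*} [MeasurableSpace α] {μ : Measure α}
    {f g : α → ℝ} (hf0 : 0 ≤ f) (hg0 : 0 ≤ g) (hf : MemLp f 2 μ) (hg : MemLp g 2 μ) :
    ∫ x, f x * g x ∂μ ≤ √(∫ x, f x ^ 2 ∂μ) * √(∫ x, g x ^ 2 ∂μ) := by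
  have h := integral_mul_le_Lp_mul_Lq_of_nonneg Real.HolderConjugate.two_two
    (ae_of_all μ hf0) (ae_of_all μ hg0) (by simpa using hf) (by simpa using hg)
  simpa [Real.sqrt_eq_rpow] using h

/-- The Ladyzhenskaya inequality with a Lipschitz weight. -/
theorem exists_integral_weight_sq_mul_norm_pow_four_le :
    ∃ K : ℝ, 0 ≤ K ∧ ∀ (w : EuclideanSpace ℝ (Fin 2) → ℝ) (L : ℝ), ContDiff ℝ 1 w →
      HasCompactSupport w → (∀ x, 0 ≤ w x) → (∀ x, ‖fderiv ℝ w x‖ ≤ L) →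
      ∀ g : EuclideanSpace ℝ (Fin 2) → ℂ, ContDiff ℝ 1 g → MemLp g 2 →
      ∫ x, w x ^ 2 * ‖g x‖ ^ 4 ≤
        K * (8 * ((∫ x, w x ^ 2 * ∑ i : Fin 2, ‖pd i g x‖ ^ 2) * (∫ x, ‖g x‖ ^ 2))
          + 2 * L ^ 2 * (∫ x, ‖g x‖ ^ 2) ^ 2) := by
  obtain ⟨K, hK, hSob⟩ := exists_integral_norm_sq_le_integral_norm_fderiv_sq
  refine ⟨K, hK, fun w L hw hwc hw0 hL g hg hg2 => ?_⟩
  set G := ∫ x, ‖g x‖ ^ 2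
  set P := ∫ x, w x ^ 2 * ∑ i : Fin 2, ‖pd i g x‖ ^ 2
  have hG : 0 ≤ G := integral_nonneg fun x => by positivity
  have hP : 0 ≤ P := integral_nonneg fun x => by positivity
  have hL0 : 0 ≤ L := (norm_nonneg _).trans (hL 0)
  have hgi : Integrable fun x => ‖g x‖ ^ 2 := hg2.integrable_norm_pow (p := 2) two_ne_zero
  have hdg : Continuous (fderiv ℝ g) := hg.continuous_fderiv one_ne_zero
  have hf : Continuous fun x => w x * ‖fderiv ℝ g x‖ := hw.continuous.mul hdg.norm
  have hf2 : MemLp (fun x => w x * ‖fderiv ℝ g x‖) 2 :=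
    hf.memLp_of_hasCompactSupport hwc.mul_right
  have hfg : Integrable fun x => (w x * ‖fderiv ℝ g x‖) * ‖g x‖ :=
    (hf.mul hg.continuous.norm).integrable_of_hasCompactSupport hwc.mul_right.mul_right
  let u : EuclideanSpace ℝ (Fin 2) → ℂ := fun x => w x • g x ^ 2
  have hu : ContDiff ℝ 1 u := hw.smul (hg.pow 2)
  have huc : HasCompactSupport u := hwc.smul_right
  have hdu : ∀ x, ‖fderiv ℝ u x‖ ≤ L * ‖g x‖ ^ 2 + 2 * ((w x * ‖fderiv ℝ g x‖) * ‖g x‖) := by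
    intro x
    have hgx := (hg.differentiable one_ne_zero x).hasFDerivAt
    have hwx := (hw.differentiable one_ne_zero x).hasFDerivAt
    rw [(hwx.fun_smul (hgx.pow 2)).fderiv]
    refine (norm_add_le _ _).trans ?_
    rw [add_comm]
    gcongr
    · refine (ContinuousLinearMap.norm_smulRight_apply _ _).trans_le ?_
      rw [norm_pow]
      gcongr
      exact hL x
    · simp [norm_smul, abs_of_nonneg (hw0 x)]
      exact le_of_eq (by ring)
  have hCS : ∫ x, (w x * ‖fderiv ℝ g x‖) * ‖g x‖ ≤ √P * √G := by
    refine (integral_mul_le_sqrt_mul_sqrt (fun x => mul_nonneg (hw0 x) (norm_nonneg _))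
      (fun x => norm_nonneg _) hf2 hg2.norm).trans ?_
    gcongr
    refine integral_mono_of_nonneg (ae_of_all _ fun x => by positivity) ?_
      (ae_of_all _ fun x => ?_)
    · refine Continuous.integrable_of_hasCompactSupport ?_ ?_
      · unfold pd
        have := hw.continuous
        fun_prop
      · exact (hwc.comp_left (g := fun t : ℝ => t ^ 2) (by simp)).mul_right
    · simp only [mul_pow]
      gcongr
      exact norm_fderiv_sq_le_sum_pd_sq g x
  have hI : ∫ x, ‖fderiv ℝ u x‖ ≤ L * G + 2 * (√P * √G) := by
    calc ∫ x, ‖fderiv ℝ u x‖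
        ≤ ∫ x, (L * ‖g x‖ ^ 2 + 2 * ((w x * ‖fderiv ℝ g x‖) * ‖g x‖)) :=
          integral_mono_of_nonneg (ae_of_all _ fun x => norm_nonneg _)
            ((hgi.const_mul L).add (hfg.const_mul 2)) (ae_of_all _ hdu)
      _ = L * G + 2 * ∫ x, (w x * ‖fderiv ℝ g x‖) * ‖g x‖ := by
          rw [integral_add (hgi.const_mul L) (hfg.const_mul 2), integral_const_mul,
            integral_const_mul]
      _ ≤ L * G + 2 * (√P * √G) := by gcongr
  calc ∫ x, w x ^ 2 * ‖g x‖ ^ 4 = ∫ x, ‖u x‖ ^ 2 := by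
        congr 1 with x
        simp only [u, norm_smul, norm_pow, mul_pow, Real.norm_eq_abs, sq_abs]
        ring
    _ ≤ K * (∫ x, ‖fderiv ℝ u x‖) ^ 2 := hSob u hu huc
    _ ≤ K * (L * G + 2 * (√P * √G)) ^ 2 := by
        have : 0 ≤ ∫ x, ‖fderiv ℝ u x‖ := integral_nonneg fun _ => norm_nonneg _
        gcongr
    _ ≤ K * (8 * (P * G) + 2 * L ^ 2 * G ^ 2) := by
        gcongr
        refine add_sq_le.trans_eq ?_
        simp only [mul_pow, Real.sq_sqrt hP, Real.sq_sqrt hG]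
        ring

/-- Localized two-dimensional interpolation (Ladyzhenskaya) inequality:
for a smooth cutoff `χ` with `0 ≤ χ ≤ 1`, `χ = 1` on `{|x| ≤ 1}` and `χ` supported in
`{|x| ≤ 2}`, there is `C > 0` depending only on `χ` such that for all `R > 0` and all
Schwartz `g : ℝ² → ℂ`,
`∫ χ(x/(2R))²|g|⁴ ≤ C (‖χ(·/(2R))∇g‖₂² ‖g‖₂² + R⁻² ‖g‖₂⁴)`. -/
theorem localized_ladyzhenskaya (χ : EuclideanSpace ℝ (Fin 2) → ℝ)
    (hχsmooth : ContDiff ℝ (⊤ : ℕ∞) χ)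
    (hχ01 : ∀ x, 0 ≤ χ x ∧ χ x ≤ 1)
    (hχone : ∀ x, ‖x‖ ≤ 1 → χ x = 1)
    (hχsupp : ∀ x, 2 < ‖x‖ → χ x = 0) :
    ∃ C > (0:ℝ), ∀ R : ℝ, 0 < R → ∀ g : SchwartzMap (EuclideanSpace ℝ (Fin 2)) ℂ,
      ∫ x, χ ((2 * R)⁻¹ • x) ^ 2 * ‖g x‖ ^ 4 ≤
        C * ((∫ x, χ ((2 * R)⁻¹ • x) ^ 2 * ∑ i : Fin 2, ‖pd i (fun y => g y) x‖ ^ 2)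
              * (∫ x, ‖g x‖ ^ 2)
            + R⁻¹ ^ 2 * (∫ x, ‖g x‖ ^ 2) ^ 2) := by
  obtain ⟨K, hK, h⟩ := exists_integral_weight_sq_mul_norm_pow_four_le
  have hχc : HasCompactSupport χ :=
    HasCompactSupport.intro (isCompact_closedBall 0 2) fun x hx =>
      hχsupp x (by simpa using hx)
  have hχ1 : ContDiff ℝ 1 χ := hχsmooth.of_le (by exact_mod_cast le_top)
  obtain ⟨M, hM⟩ := (hχ1.continuous_fderiv one_ne_zero).bounded_above_of_compact_support
    (hχc.fderiv ℝ)
  refine ⟨K * (8 + M ^ 2) + 1, by positivity, fun R hR g => ?_⟩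
  have hc : (2 * R)⁻¹ ≠ 0 := by positivity
  refine (h (fun x => χ ((2 * R)⁻¹ • x)) ((2 * R)⁻¹ * M) (hχ1.comp (contDiff_const_smul _))
    (hχc.comp_smul hc) (fun x => (hχ01 _).1) (fun x => ?_) g (g.smooth 1) (g.memLp 2)).trans ?_
  · rw [fderiv_comp_smul, norm_smul, Real.norm_of_nonneg (by positivity)]
    gcongr
    exact hM _
  · set G := ∫ x, ‖g x‖ ^ 2
    set P := ∫ x, χ ((2 * R)⁻¹ • x) ^ 2 * ∑ i : Fin 2, ‖pd i (fun y => g y) x‖ ^ 2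
    have hPG : 0 ≤ P * G :=
      mul_nonneg (integral_nonneg fun x => by positivity) (integral_nonneg fun x => by positivity)
    have hRG : 0 ≤ R⁻¹ ^ 2 * G ^ 2 := by positivity
    have e : 2 * ((2 * R)⁻¹ * M) ^ 2 * G ^ 2 = M ^ 2 / 2 * (R⁻¹ ^ 2 * G ^ 2) := by
      rw [mul_inv]; ring
    rw [e]
    have h1 : 8 * (P * G) + M ^ 2 / 2 * (R⁻¹ ^ 2 * G ^ 2)
        ≤ (8 + M ^ 2) * (P * G + R⁻¹ ^ 2 * G ^ 2) := by
      nlinarith [mul_nonneg (sq_nonneg M) hPG, mul_nonneg (sq_nonneg M) hRG]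
    calc K * (8 * (P * G) + M ^ 2 / 2 * (R⁻¹ ^ 2 * G ^ 2))
        ≤ K * ((8 + M ^ 2) * (P * G + R⁻¹ ^ 2 * G ^ 2)) := by gcongr
      _ ≤ (K * (8 + M ^ 2) + 1) * (P * G + R⁻¹ ^ 2 * G ^ 2) := by linarith
end
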